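/- For k = 0, 1, 2, 3, the identity (c_k^- / c_4^-) · (-LM)^{k-4} = c_k^+ / c_4^+ holds in ℚ(M,L), where c_k^- is obtained from c_k by the substitution (M,L) ↦ (√M, L/M^5) and c_k^+ is obtained from c_k by the substitution (M,L) ↦ (i/√L, L^5/M). -/

import Mathlib

set_option maxHeartbeats 1000000

/- STATEMENT 3: For k = 0,1,2,3, (c_k⁻ / c_4⁻)·(-LM)^(k-4) = c_k⁺ / c_4⁺ in
ℚ(i)(M,L), where c_k⁻ = c_k(√M, L/M⁵) and c_k⁺ = c_k(i/√L, L⁵/M).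
We work in K = Frac(ℤ[i][m,l]) = ℚ(i)(m,l) with M = m², L = l². -/

/-- The coefficients c_k as functions of their two arguments (M,L), over any field. -/
noncomputable def cc {K : Type*} [Field K] : ℕ → K → K → K
  | 4, X, _ => X^4
  | 3, X, Y => 1+X^4+2*Y*X^12+Y*X^14-Y*X^16+Y^2*X^20-Y^2*X^22-2*Y^2*X^24-Y^3*X^32-Y^3*X^36
  | 2, X, Y => (-1+Y*X^12)*(-1-2*Y*X^10-3*Y*X^12+2*Y*X^14-Y^2*X^16+2*Y^2*X^18
      -4*Y^2*X^20-2*Y^2*X^22+3*Y^2*X^24-3*Y^3*X^28+2*Y^3*X^30+4*Y^3*X^32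
      -2*Y^3*X^34+Y^3*X^36-2*Y^4*X^38+3*Y^4*X^40+2*Y^4*X^42+Y^5*X^52)
  | 1, X, Y => -Y^2*(X-1)^2*X^16*(X+1)^2*(1+Y*X^10)^2*(-1-X^4-2*Y*X^12-Y*X^14
      +Y*X^16-Y^2*X^20+Y^2*X^22+2*Y^2*X^24+Y^3*X^32+Y^3*X^36)
  | 0, X, Y => Y^4*(X-1)^4*X^36*(X+1)^4*(1+Y*X^10)^4
  | _, _, _ => 0

abbrev Ki : Type := FractionRing (MvPolynomial (Fin 2) GaussianInt)

/-- √M -/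
noncomputable def m : Ki := algebraMap (MvPolynomial (Fin 2) GaussianInt) Ki (MvPolynomial.X 0)
/-- √L -/
noncomputable def l : Ki := algebraMap (MvPolynomial (Fin 2) GaussianInt) Ki (MvPolynomial.X 1)
/-- the imaginary unit i ∈ ℚ(i) ⊆ K -/
noncomputable def i : Ki :=
  algebraMap (MvPolynomial (Fin 2) GaussianInt) Ki (MvPolynomial.C Zsqrtd.sqrtd)

noncomputable def M : Ki := m^2
noncomputable def L : Ki := l^2

/-- c_k⁻ : the substitution (M,L) ↦ (√M, L/M⁵). -/
noncomputable def cminus (k : ℕ) : Ki := cc k m (L / M^5)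

/-- c_k⁺ : the substitution (M,L) ↦ (i/√L, L⁵/M). -/
noncomputable def cplus (k : ℕ) : Ki := cc k (i / l) (L^5 / M)

theorem m_ne_zero : m ≠ 0 := by
  unfold m
  rw [Ne, FaithfulSMul.algebraMap_eq_zero_iff]
  exact MvPolynomial.X_ne_zero 0

theorem l_ne_zero : l ≠ 0 := by
  unfold l
  rw [Ne, FaithfulSMul.algebraMap_eq_zero_iff]
  exact MvPolynomial.X_ne_zero 1

theorem i_sq : i ^ 2 = -1 := by
  unfold i
  rw [← map_pow, ← map_pow, show (Zsqrtd.sqrtd : GaussianInt) ^ 2 = -1 by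
    rw [sq, Zsqrtd.dmuld]; rfl]
  simp

/-- The coefficient identity over an arbitrary field containing a square root `I` of `-1`. -/
theorem cc_identity {K : Type*} [Field K] (x y I : K) (hx : x ≠ 0) (hy : y ≠ 0)
    (hI : I ^ 2 = -1) (k : ℕ) (hk : k ≤ 3) :
    (cc k x (y ^ 2 / (x ^ 2) ^ 5) / cc 4 x (y ^ 2 / (x ^ 2) ^ 5)) *
        (-(y ^ 2 * x ^ 2)) ^ ((k : ℤ) - 4) =
      cc k (I / y) ((y ^ 2) ^ 5 / x ^ 2) / cc 4 (I / y) ((y ^ 2) ^ 5 / x ^ 2) := by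
  have hpow (n : ℕ) : (I / y) ^ (2 * n) = (-1) ^ n / y ^ (2 * n) := by
    rw [div_pow, pow_mul, hI]
  have h4 := hpow 2
  have h10 := hpow 5
  have h12 := hpow 6
  have h14 := hpow 7
  have h16 := hpow 8
  have h18 := hpow 9
  have h20 := hpow 10
  have h22 := hpow 11
  have h24 := hpow 12
  have h28 := hpow 14
  have h30 := hpow 15
  have h32 := hpow 16
  have h34 := hpow 17
  have h36 := hpow 18
  have h38 := hpow 19
  have h40 := hpow 20
  have h42 := hpow 21
  have h52 := hpow 26
  have hsub : (I / y - 1) * (I / y + 1) = -(1 + y ^ 2) / y ^ 2 := by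
    field_simp
    linear_combination hI
  norm_num at h4 h10 h12 h14 h16 h18 h20 h22 h24 h28 h30 h32 h34 h36 h38 h40 h42 h52
  interval_cases k
  · have hz : (-(y ^ 2 * x ^ 2)) ^ (((0 : ℕ) : ℤ) - 4) = 1 / (y ^ 2 * x ^ 2) ^ 4 := by
      rw [show (((0 : ℕ) : ℤ) - 4) = -((4 : ℕ) : ℤ) by norm_num, zpow_neg, zpow_natCast]
      ring
    have hc (Y X : K) : Y ^ 4 * (X - 1) ^ 4 * X ^ 36 * (X + 1) ^ 4 * (1 + Y * X ^ 10) ^ 4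
        = Y ^ 4 * ((X - 1) * (X + 1)) ^ 4 * X ^ 36 * (1 + Y * X ^ 10) ^ 4 := by ring
    rw [hz]
    simp only [cc]
    rw [hc ((y ^ 2) ^ 5 / x ^ 2), hsub, h4, h10, h36]
    field_simp
    ring
  · have hz : (-(y ^ 2 * x ^ 2)) ^ (((1 : ℕ) : ℤ) - 4) = -1 / (y ^ 2 * x ^ 2) ^ 3 := by
      rw [show (((1 : ℕ) : ℤ) - 4) = -((3 : ℕ) : ℤ) by norm_num, zpow_neg, zpow_natCast,
        Odd.neg_pow (by decide), inv_neg]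
      ring
    have hc (Y X Z : K) : -Y ^ 2 * (X - 1) ^ 2 * X ^ 16 * (X + 1) ^ 2 * (1 + Y * X ^ 10) ^ 2 * Z
        = -Y ^ 2 * ((X - 1) * (X + 1)) ^ 2 * X ^ 16 * (1 + Y * X ^ 10) ^ 2 * Z := by ring
    rw [hz]
    simp only [cc]
    rw [hc ((y ^ 2) ^ 5 / x ^ 2), hsub, h4, h10, h12, h14, h16, h20, h22, h24, h32, h36]
    field_simp
    ring
  · have hz : (-(y ^ 2 * x ^ 2)) ^ (((2 : ℕ) : ℤ) - 4) = 1 / (y ^ 2 * x ^ 2) ^ 2 := by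
      rw [show (((2 : ℕ) : ℤ) - 4) = -((2 : ℕ) : ℤ) by norm_num, zpow_neg, zpow_natCast]
      ring
    rw [hz]
    simp only [cc]
    rw [h4, h10, h12, h14, h16, h18, h20, h22, h24, h28, h30, h32, h34, h36, h38, h40, h42, h52]
    field_simp
    ring
  · have hz : (-(y ^ 2 * x ^ 2)) ^ (((3 : ℕ) : ℤ) - 4) = -1 / (y ^ 2 * x ^ 2) := by
      rw [show (((3 : ℕ) : ℤ) - 4) = -1 by norm_num, zpow_neg_one, inv_neg]
      ring
    rw [hz]
    simp only [cc]
    rw [h4, h12, h14, h16, h20, h22, h24, h32, h36]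
    field_simp
    ring

theorem coeff_identity :
    ∀ k : ℕ, k ≤ 3 →
      (cminus k / cminus 4) * (-(L * M)) ^ ((k : ℤ) - 4) = cplus k / cplus 4 :=
  fun k hk => cc_identity m l i m_ne_zero l_ne_zero i_sq k hk
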